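/- Let X and Y be finite index sets, let P_X be a probability distribution on X, and for each x ∈ X let C_x and D_x be probability distributions on Y (conditional distributions P_{Y|X=x} and Q_{Y|X=x}, with nonnegative entries summing to 1). For the joint distributions on X × Y given by P_{XY}(x,y) = P_X(x)·C_x(y) and Q_{XY}(x,y) = P_X(x)·D_x(y) (marginal unchanged, conditionals change), one has DL(P_{XY}, Q_{XY}) = ∑_{x∈X} P_X(x) · DL(C_x, D_x). -/

import Mathlib

open Real Finset

/-- lit(p,q) = |p(1 - log p) - q(1 - log q)|, natural log, with 0*log 0 = 0
(automatic since Real.log 0 = 0). -/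
noncomputable def lit (p q : ℝ) : ℝ :=
  |p * (1 - Real.log p) - q * (1 - Real.log q)|

/-- δh(p,q) = |p²(1 - 2 log p) - q²(1 - 2 log q)| / (2(p+q)), with δh(0,0) = 0
(automatic since division by zero is 0 in Lean). -/
noncomputable def deltaH (p q : ℝ) : ℝ :=
  |p ^ 2 * (1 - 2 * Real.log p) - q ^ 2 * (1 - 2 * Real.log q)| / (2 * (p + q))

/-- dl(p,q) = lit(p,q) - δh(p,q). -/
noncomputable def dl (p q : ℝ) : ℝ := lit p q - deltaH p q

/-- DLITE of two distributions on a finite index set: DL(P,Q) = ∑ i, dl(P i, Q i). -/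
noncomputable def DL {ι : Type*} [Fintype ι] (P Q : ι → ℝ) : ℝ :=
  ∑ i, dl (P i) (Q i)

/-- `IsProbDist P` : nonnegative real entries summing to 1. -/
def IsProbDist {ι : Type*} [Fintype ι] (P : ι → ℝ) : Prop :=
  (∀ i, 0 ≤ P i) ∧ ∑ i, P i = 1

theorem mul_one_sub_log_le {p q : ℝ} (hq : 0 ≤ q) (hqp : q ≤ p) (hp : p ≤ 1) :
    q * (1 - Real.log q) ≤ p * (1 - Real.log p) := by
  have hlogp : Real.log p ≤ 0 := Real.log_nonpos (hq.trans hqp) hp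
  rcases hq.eq_or_lt with rfl | hq0
  · rw [zero_mul]
    exact mul_nonneg hqp (by linarith)
  have hp0 : 0 < p := hq0.trans_le hqp
  have h := Real.log_le_sub_one_of_pos (div_pos hp0 hq0)
  rw [Real.log_div hp0.ne' hq0.ne'] at h
  have h₁ := mul_le_mul_of_nonneg_left h hq0.le
  have h₂ : q * (p / q - 1) = p - q := by field_simp
  nlinarith [mul_nonneg (sub_nonneg.2 hqp) (neg_nonneg.2 hlogp)]

theorem lit_of_le {p q : ℝ} (hq : 0 ≤ q) (hqp : q ≤ p) (hp : p ≤ 1) :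
    lit p q = p * (1 - Real.log p) - q * (1 - Real.log q) :=
  abs_of_nonneg (sub_nonneg.2 (mul_one_sub_log_le hq hqp hp))

theorem deltaH_of_le {p q : ℝ} (hq : 0 ≤ q) (hqp : q ≤ p) (hp : p ≤ 1) :
    deltaH p q =
      (p ^ 2 * (1 - 2 * Real.log p) - q ^ 2 * (1 - 2 * Real.log q)) / (2 * (p + q)) := by
  have h := mul_one_sub_log_le (sq_nonneg q) (pow_le_pow_left₀ hq hqp 2)
    (pow_le_one₀ (hq.trans hqp) hp)
  rw [Real.log_pow, Real.log_pow] at h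
  push_cast at h
  rw [deltaH, abs_of_nonneg (sub_nonneg.2 h)]

theorem dl_comm (p q : ℝ) : dl p q = dl q p := by
  rw [dl, dl, lit, lit, deltaH, deltaH, abs_sub_comm, abs_sub_comm (p ^ 2 * _), add_comm p q]

theorem mul_log_mul {c : ℝ} (hc : c ≠ 0) (p : ℝ) :
    p * Real.log (c * p) = p * (Real.log c + Real.log p) := by
  rcases eq_or_ne p 0 with rfl | hp
  · simp
  · rw [Real.log_mul hc hp]

theorem dl_mul_of_le {c p q : ℝ} (hc : 0 ≤ c) (hc1 : c ≤ 1) (hq : 0 ≤ q) (hqp : q ≤ p)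
    (hp : p ≤ 1) : dl (c * p) (c * q) = c * dl p q := by
  rcases hc.eq_or_lt with rfl | hc0
  · simp [dl, lit, deltaH]
  rcases (hq.trans hqp).eq_or_lt with rfl | hp0
  · obtain rfl : q = 0 := le_antisymm hqp hq
    simp [dl, lit, deltaH]
  have hcq : 0 ≤ c * q := mul_nonneg hc hq
  have hcqp : c * q ≤ c * p := mul_le_mul_of_nonneg_left hqp hc
  have hcp : c * p ≤ 1 := mul_le_one₀ hc1 hp0.le hp
  rw [dl, dl, lit_of_le hcq hcqp hcp, lit_of_le hq hqp hp, deltaH_of_le hcq hcqp hcp,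
    deltaH_of_le hq hqp hp]
  have hpq : p + q ≠ 0 := by positivity
  have hc' : c ≠ 0 := hc0.ne'
  have h₁ := mul_log_mul hc' p
  have h₂ := mul_log_mul hc' q
  field_simp
  linear_combination (-2 * (p + q) + 2 * p) * h₁ + (2 * (p + q) - 2 * q) * h₂

theorem dl_mul {c p q : ℝ} (hc : 0 ≤ c) (hc1 : c ≤ 1) (hp : 0 ≤ p) (hp1 : p ≤ 1)
    (hq : 0 ≤ q) (hq1 : q ≤ 1) : dl (c * p) (c * q) = c * dl p q := by
  rcases le_total q p with h | h
  · exact dl_mul_of_le hc hc1 hq h hp1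
  · rw [dl_comm, dl_comm p, dl_mul_of_le hc hc1 hp h hq1]

theorem IsProbDist.le_one {ι : Type*} [Fintype ι] {P : ι → ℝ} (hP : IsProbDist P) (i : ι) :
    P i ≤ 1 :=
  hP.2 ▸ Finset.single_le_sum (fun j _ => hP.1 j) (Finset.mem_univ i)

theorem DL_joint_conditional_change {X Y : Type*} [Fintype X] [Fintype Y]
    (PX : X → ℝ) (C D : X → Y → ℝ)
    (hPX : IsProbDist PX) (hC : ∀ x, IsProbDist (C x)) (hD : ∀ x, IsProbDist (D x)) :
    DL (fun z : X × Y => PX z.1 * C z.1 z.2) (fun z : X × Y => PX z.1 * D z.1 z.2) =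
      ∑ x, PX x * DL (C x) (D x) := by
  simp only [DL, Fintype.sum_prod_type, Finset.mul_sum]
  exact Finset.sum_congr rfl fun x _ => Finset.sum_congr rfl fun y _ =>
    dl_mul (hPX.1 x) (hPX.le_one x) ((hC x).1 y) ((hC x).le_one y) ((hD x).1 y) ((hD x).le_one y)
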